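/- arXiv:1611.09184 — 2 statements merged into one kernel-verified Lean document; each statement's English description precedes it below -/
import Mathlib

section
/- Assume the average value h̄ of h is negative and h_i > 0 for at least one vertex i ∈ V. Let S = {c ∈ ℝ : c < 0 and there exists u : V → ℝ with Δu = c − h·e^u}. Then S is nonempty and bounded below, sInf S < 0, and there exists a function u : V → ℝ solving Δu = (sInf S) − h·e^u; in other words, the Kazdan–Warner equation is solvable at c = c_-(h) := sInf S. -/
/-- The graph Laplacian: `(Δ f)_i = (1/μ_i) ∑_{j ∼ i} ω_{ij} (f_j - f_i)`. -/
noncomputable def glap {V : Type*} [Fintype V] (G : SimpleGraph V) [DecidableRel G.Adj]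
    (μ : V → ℝ) (ω : V → V → ℝ) (f : V → ℝ) (i : V) : ℝ :=
  (1 / μ i) * ∑ j ∈ G.neighborFinset i, ω i j * (f j - f i)

/-- Unnormalised Laplacian. -/
noncomputable def ulap {V : Type*} [Fintype V] (G : SimpleGraph V) [DecidableRel G.Adj]
    (ω : V → V → ℝ) (f : V → ℝ) (i : V) : ℝ :=
  ∑ j ∈ G.neighborFinset i, ω i j * (f j - f i)

/-- `u` solves the Kazdan–Warner equation, multiplied by the measure. -/
def KWSol {V : Type*} [Fintype V] (G : SimpleGraph V) [DecidableRel G.Adj]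
    (μ : V → ℝ) (ω : V → V → ℝ) (h : V → ℝ) (c : ℝ) (u : V → ℝ) : Prop :=
  ∀ i, ulap G ω u i = μ i * (c - h i * Real.exp (u i))

section KW
variable {V : Type*} [Fintype V] (G : SimpleGraph V) [DecidableRel G.Adj]

theorem kwsol_iff (μ : V → ℝ) (hμ : ∀ i, 0 < μ i) (ω : V → V → ℝ) (h : V → ℝ) (c : ℝ)
    (u : V → ℝ) :
    (∀ i, glap G μ ω u i = c - h i * Real.exp (u i)) ↔ KWSol G μ ω h c u := by
  refine forall_congr' fun i => ?_
  have h1 : glap G μ ω u i = ulap G ω u i / μ i := by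
    unfold glap ulap; ring
  rw [h1, div_eq_iff (hμ i).ne', mul_comm]

theorem ulap_le (ω : V → V → ℝ) (hω : ∀ i j, G.Adj i j → 0 < ω i j) (u : V → ℝ) (i : V) (K : ℝ)
    (hK : ∀ j, u j - u i ≤ K) :
    ulap G ω u i ≤ (∑ j ∈ G.neighborFinset i, ω i j) * K := by
  unfold ulap
  rw [Finset.sum_mul]
  refine Finset.sum_le_sum fun j hj => ?_
  exact mul_le_mul_of_nonneg_left (hK j) (hω i j (by simpa using hj)).le

theorem le_ulap (ω : V → V → ℝ) (hω : ∀ i j, G.Adj i j → 0 < ω i j) (u : V → ℝ) (i : V) (K : ℝ)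
    (hK : ∀ j, K ≤ u j - u i) :
    (∑ j ∈ G.neighborFinset i, ω i j) * K ≤ ulap G ω u i := by
  unfold ulap
  rw [Finset.sum_mul]
  refine Finset.sum_le_sum fun j hj => ?_
  exact mul_le_mul_of_nonneg_left (hK j) (hω i j (by simpa using hj)).le

theorem deg_nonneg (ω : V → V → ℝ) (hω : ∀ i j, G.Adj i j → 0 < ω i j) (i : V) :
    0 ≤ ∑ j ∈ G.neighborFinset i, ω i j :=
  Finset.sum_nonneg fun j hj => (hω i j (by simpa using hj)).le

theorem ulap_sum (ω : V → V → ℝ) (hsym : ∀ i j, ω i j = ω j i) (u : V → ℝ) :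
    ∑ i, ulap G ω u i = 0 := by
  have h1 : ∀ i, ulap G ω u i = ∑ j, if G.Adj i j then ω i j * (u j - u i) else 0 := by
    intro i
    unfold ulap
    rw [← Finset.sum_filter]
    refine Finset.sum_congr ?_ fun _ _ => rfl
    ext j; simp
  have h2 : ∑ i, ulap G ω u i = - ∑ i, ulap G ω u i := by
    simp only [h1]
    conv_lhs => rw [Finset.sum_comm]
    rw [← Finset.sum_neg_distrib]
    refine Finset.sum_congr rfl fun i _ => ?_
    rw [← Finset.sum_neg_distrib]
    refine Finset.sum_congr rfl fun j _ => ?_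
    rw [hsym j i]
    by_cases hij : G.Adj i j
    · rw [if_pos hij, if_pos hij.symm]; ring
    · rw [if_neg hij, if_neg (fun hh => hij hh.symm)]; ring
  linarith

theorem ulap_zero_const (hconn : G.Connected) (ω : V → V → ℝ)
    (hω : ∀ i j, G.Adj i j → 0 < ω i j) (u : V → ℝ) (hu : ∀ i, ulap G ω u i = 0) :
    ∃ a, ∀ i, u i = a := by
  have := hconn.nonempty
  obtain ⟨m, hm⟩ := Finite.exists_max u
  have key : ∀ a b, G.Adj a b → u a = u m → u b = u m := by
    intro a b hab ha
    have h0 := hu a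
    unfold ulap at h0
    have h1 := (Finset.sum_eq_zero_iff_of_nonpos (fun j hj => by
      have h2 := hω a j (by simpa using hj)
      have h3 := hm j
      nlinarith)).1 h0 b (by simpa using hab)
    rcases mul_eq_zero.1 h1 with h2 | h2
    · exact absurd h2 (hω a b hab).ne'
    · linarith
  refine ⟨u m, fun i => ?_⟩
  obtain ⟨p⟩ := hconn.preconnected m i
  have : ∀ {a b : V} (p : G.Walk a b), u a = u m → u b = u m := by
    intro a b p
    induction p with
    | nil => exact id
    | cons hadj p ih => exact fun ha => ih (key _ _ hadj ha)
  exact this p rfl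

theorem poisson (hconn : G.Connected) (μ : V → ℝ) (hμ : ∀ i, 0 < μ i)
    (ω : V → V → ℝ) (hsym : ∀ i j, ω i j = ω j i)
    (hω : ∀ i j, G.Adj i j → 0 < ω i j) (h : V → ℝ) (hneg : ∑ i, μ i * h i < 0) :
    ∃ (v : V → ℝ) (m : ℝ), 0 < m ∧ ∀ i, ulap G ω v i = μ i * (- h i - m) := by
  have := hconn.nonempty
  have hM : 0 < ∑ i, μ i := Finset.sum_pos (fun i _ => hμ i) Finset.univ_nonempty
  let T : (V → ℝ) →ₗ[ℝ] (V → ℝ) :=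
    { toFun := fun f i => ulap G ω f i + μ i * ∑ k, f k
      map_add' := by
        intro f g; ext i
        simp only [ulap, Pi.add_apply, Finset.sum_add_distrib, mul_add, mul_sub,
          Finset.sum_sub_distrib]
        ring
      map_smul' := by
        intro a f; ext i
        simp only [ulap, Pi.smul_apply, smul_eq_mul, RingHom.id_apply, mul_add, Finset.mul_sum]
        congr 1
        · exact Finset.sum_congr rfl fun j _ => by ring
        · exact Finset.sum_congr rfl fun j _ => by ring }
  have hT : ∀ f i, T f i = ulap G ω f i + μ i * ∑ k, f k := fun f i => rfl
  have hTs : ∀ f, ∑ i, T f i = (∑ i, μ i) * ∑ k, f k := by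
    intro f
    simp only [hT, Finset.sum_add_distrib, ulap_sum G ω hsym f, zero_add, ← Finset.sum_mul]
  have hinj : Function.Injective T := by
    rw [injective_iff_map_eq_zero]
    intro f hf
    have h1 := hTs f
    rw [hf] at h1
    simp only [Pi.zero_apply, Finset.sum_const_zero] at h1
    have h2 : ∑ k, f k = 0 := by
      rcases mul_eq_zero.1 h1.symm with h3 | h3
      · exact absurd h3 hM.ne'
      · exact h3
    obtain ⟨a, ha⟩ := ulap_zero_const G hconn ω hω f (fun i => by
      have := hT f i
      rw [hf, h2] at this
      simpa using this.symm)
    have h3 : (Fintype.card V : ℝ) * a = 0 := by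
      rw [← h2]; simp [ha]
    have h4 : a = 0 := by
      rcases mul_eq_zero.1 h3 with h5 | h5
      · exact absurd h5 (by simp)
      · exact h5
    ext i; rw [ha i, h4]; rfl
  obtain ⟨v, hv⟩ := LinearMap.injective_iff_surjective.1 hinj (fun i => - (μ i * h i))
  refine ⟨v, ∑ k, v k, ?_, fun i => ?_⟩
  · have h1 := hTs v
    rw [hv, Finset.sum_neg_distrib] at h1
    by_contra hc
    nlinarith
  · have h1 := hT v i
    rw [hv] at h1
    simp only at h1
    linarith

theorem sub_super (μ : V → ℝ) (hμ : ∀ i, 0 < μ i)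
    (ω : V → V → ℝ) (hω : ∀ i j, G.Adj i j → 0 < ω i j) (h : V → ℝ) (c : ℝ) (φ ψ : V → ℝ)
    (hle : φ ≤ ψ) (hφ : ∀ i, μ i * (c - h i * Real.exp (φ i)) ≤ ulap G ω φ i)
    (hψ : ∀ i, ulap G ω ψ i ≤ μ i * (c - h i * Real.exp (ψ i))) :
    ∃ u, KWSol G μ ω h c u := by
  classical
  have hcont : ∀ i, Continuous fun w : V → ℝ => ulap G ω w i := by
    intro i; unfold ulap; fun_prop
  let P : Set (V → ℝ) := Set.Icc φ ψ ∩
    ⋂ i, {w | μ i * (c - h i * Real.exp (w i)) ≤ ulap G ω w i}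
  have hP : IsCompact P := by
    refine isCompact_Icc.inter_right (isClosed_iInter fun i => ?_)
    exact isClosed_le (by fun_prop) (hcont i)
  obtain ⟨w, hwP, hmax⟩ := hP.exists_isMaxOn (f := fun w : V → ℝ => ∑ i, w i)
    ⟨φ, ⟨le_refl _, hle⟩, Set.mem_iInter.2 hφ⟩ (by fun_prop)
  have hw2 : ∀ i, μ i * (c - h i * Real.exp (w i)) ≤ ulap G ω w i := Set.mem_iInter.1 hwP.2
  refine ⟨w, fun i => ?_⟩
  by_contra hne
  have hlt : μ i * (c - h i * Real.exp (w i)) < ulap G ω w i :=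
    lt_of_le_of_ne (hw2 i) (Ne.symm hne)
  have hwψ : w i < ψ i := by
    refine lt_of_le_of_ne (hwP.1.2 i) fun heq => ?_
    have h1 : ulap G ω w i ≤ ulap G ω ψ i := by
      unfold ulap
      refine Finset.sum_le_sum fun j hj => ?_
      have := hwP.1.2 j
      exact mul_le_mul_of_nonneg_left (by linarith) (hω i j (by simpa using hj)).le
    have h2 := hψ i
    rw [← heq] at h2
    linarith
  have hev1 : ∀ᶠ x in nhdsWithin (w i) (Set.Ioi (w i)),
      μ i * (c - h i * Real.exp x) < ulap G ω (Function.update w i x) i := by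
    refine nhdsWithin_le_nhds ?_
    have hc1 : Continuous fun x : ℝ => μ i * (c - h i * Real.exp x) := by fun_prop
    have hc2 : Continuous fun x : ℝ => ulap G ω (Function.update w i x) i :=
      (hcont i).comp (continuous_const.update i continuous_id)
    exact hc1.continuousAt.eventually_lt hc2.continuousAt (by simpa using hlt)
  have hev2 : ∀ᶠ x in nhdsWithin (w i) (Set.Ioi (w i)), x < ψ i :=
    nhdsWithin_le_nhds (eventually_lt_nhds hwψ)
  obtain ⟨x, ⟨hx1, hx2⟩, hx3⟩ := ((hev1.and hev2).and self_mem_nhdsWithin).exists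
  have hx3 : w i < x := hx3
  have hup : ∀ j, w j ≤ Function.update w i x j := by
    intro j
    by_cases hj : j = i
    · subst hj; simpa using hx3.le
    · simp [hj]
  have hmem : Function.update w i x ∈ P := by
    refine ⟨⟨fun j => (hwP.1.1 j).trans (hup j), fun j => ?_⟩, Set.mem_iInter.2 fun j => ?_⟩
    · by_cases hj : j = i
      · subst hj; simpa using hx2.le
      · simpa [hj] using hwP.1.2 j
    · by_cases hj : j = i
      · subst hj; simpa using hx1.le
      · have h1 : ulap G ω w j ≤ ulap G ω (Function.update w i x) j := by
          unfold ulap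
          refine Finset.sum_le_sum fun k hk => ?_
          have := hup k
          refine mul_le_mul_of_nonneg_left ?_ (hω j k (by simpa using hk)).le
          rw [Function.update_of_ne hj]
          linarith
        have h2 := hw2 j
        simp only [Set.mem_ofPred_eq]
        rw [Function.update_of_ne hj]
        linarith
  have h1 : ∑ j, Function.update w i x j ≤ ∑ j, w j := hmax hmem
  have h2 : ∑ j, w j < ∑ j, Function.update w i x j :=
    Finset.sum_lt_sum (fun j _ => hup j) ⟨i, Finset.mem_univ _, by simpa using hx3⟩
  linarith

theorem kw_nonempty (hconn : G.Connected) (μ : V → ℝ) (hμ : ∀ i, 0 < μ i)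
    (ω : V → V → ℝ) (hsym : ∀ i j, ω i j = ω j i)
    (hω : ∀ i j, G.Adj i j → 0 < ω i j) (h : V → ℝ) (hneg : ∑ i, μ i * h i < 0) :
    ∃ c < 0, ∃ u, KWSol G μ ω h c u := by
  obtain ⟨v, m, hm, hv⟩ := poisson G hconn μ hμ ω hsym hω h hneg
  have hev : ∀ᶠ a in nhdsWithin (0:ℝ) (Set.Ioi 0), ∀ i, h i * (Real.exp (a * v i) - 1) < m / 2 := by
    refine nhdsWithin_le_nhds (Filter.eventually_all.2 fun i => ?_)
    have hc1 : Continuous fun a : ℝ => h i * (Real.exp (a * v i) - 1) := by fun_prop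
    exact hc1.continuousAt.eventually_lt (continuousAt_const (y := m / 2)) (by simpa using hm)
  obtain ⟨a, ha1, ha⟩ := (hev.and self_mem_nhdsWithin).exists
  have ha : 0 < a := ha
  let c : ℝ := - (a * m / 2)
  have hc : c < 0 := by have := mul_pos ha hm; simp only [c]; linarith
  let ψ : V → ℝ := fun i => a * v i + Real.log a
  have hψ : ∀ i, ulap G ω ψ i ≤ μ i * (c - h i * Real.exp (ψ i)) := by
    intro i
    have h1 : ulap G ω ψ i = a * ulap G ω v i := by
      unfold ulap
      rw [Finset.mul_sum]
      exact Finset.sum_congr rfl fun j _ => by simp only [ψ]; ring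
    have h2 : Real.exp (ψ i) = Real.exp (a * v i) * a := by
      simp only [ψ]; rw [Real.exp_add, Real.exp_log ha]
    rw [h1, h2, hv i]
    have h3 := ha1 i
    have h4 : a * (- h i - m) ≤ c - h i * (Real.exp (a * v i) * a) := by
      simp only [c]; nlinarith
    have := mul_le_mul_of_nonneg_left h4 (hμ i).le
    linarith
  have hev2 : ∀ᶠ t in Filter.atBot, ∀ i, t ≤ ψ i ∧ c < h i * Real.exp t := by
    refine Filter.eventually_all.2 fun i => (Filter.eventually_le_atBot _).and ?_
    have := (Real.tendsto_exp_atBot.const_mul (h i))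
    rw [mul_zero] at this
    exact this.eventually (lt_mem_nhds hc)
  obtain ⟨t, ht⟩ := hev2.exists
  refine ⟨c, hc, sub_super G μ hμ ω hω h c (fun _ => t) ψ (fun i => (ht i).1) (fun i => ?_) hψ⟩
  have h1 : ulap G ω (fun _ => t) i = 0 := by simp [ulap]
  rw [h1]
  exact mul_nonpos_of_nonneg_of_nonpos (hμ i).le (by linarith [(ht i).2])

theorem kw_lower (hconn : G.Connected) (μ : V → ℝ) (hμ : ∀ i, 0 < μ i)
    (ω : V → V → ℝ) (hω : ∀ i j, G.Adj i j → 0 < ω i j) (h : V → ℝ) :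
    ∀ c u, KWSol G μ ω h c u → c < 0 → ∀ i, -c ≤ (∑ k, |h k|) * Real.exp (u i) := by
  intro c u hu hc i
  have := hconn.nonempty
  obtain ⟨m, hm⟩ := Finite.exists_min u
  have h1 := le_ulap G ω hω u m 0 (fun j => by linarith [hm j])
  rw [hu m, mul_zero] at h1
  have h2 : 0 ≤ c - h m * Real.exp (u m) := nonneg_of_mul_nonneg_right h1 (hμ m)
  have h3 : |h m| ≤ ∑ k, |h k| :=
    Finset.single_le_sum (f := fun k => |h k|) (fun k _ => abs_nonneg _) (Finset.mem_univ m)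
  have h4 := neg_abs_le (h m)
  have h5 := Real.exp_pos (u m)
  have h6 := Real.exp_le_exp.2 (hm i)
  have h7 : -c ≤ |h m| * Real.exp (u m) := by nlinarith
  exact h7.trans (mul_le_mul h3 h6 h5.le (Finset.sum_nonneg fun k _ => abs_nonneg _))

theorem kw_pos_ineq (hconn : G.Connected) (μ : V → ℝ) (ω : V → V → ℝ)
    (hω : ∀ i j, G.Adj i j → 0 < ω i j) (h : V → ℝ) (c : ℝ) (u : V → ℝ)
    (hu : KWSol G μ ω h c u) (L : ℝ) (hL : ∀ i, L ≤ u i) (i : V) :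
    μ i * (h i * Real.exp (u i) - c) ≤ (∑ j ∈ G.neighborFinset i, ω i j) * (u i - L) := by
  have h1 := le_ulap G ω hω u i (L - u i) (fun j => by linarith [hL j])
  rw [hu i] at h1
  linarith

theorem kw_bdd (hconn : G.Connected) (μ : V → ℝ) (hμ : ∀ i, 0 < μ i)
    (ω : V → V → ℝ) (hω : ∀ i j, G.Adj i j → 0 < ω i j) (h : V → ℝ) (hpos : ∃ i, 0 < h i) :
    ∃ C, ∀ c u, c < 0 → KWSol G μ ω h c u → -C ≤ c := by
  have := hconn.nonempty
  obtain ⟨i, hi⟩ := hpos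
  have hH : 0 < ∑ k, |h k| := lt_of_lt_of_le (abs_pos.2 hi.ne')
    (Finset.single_le_sum (f := fun k => |h k|) (fun k _ => abs_nonneg _) (Finset.mem_univ i))
  refine ⟨(∑ j ∈ G.neighborFinset i, ω i j) * (∑ k, |h k|) / (μ i * h i), fun c u hc hu => ?_⟩
  obtain ⟨m, hm⟩ := Finite.exists_min u
  have h1 := kw_pos_ineq G hconn μ ω hω h c u hu (u m) hm i
  have h2 := kw_lower G hconn μ hμ ω hω h c u hu hc m
  set D := ∑ j ∈ G.neighborFinset i, ω i j
  set H := ∑ k, |h k|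
  have hmi := hm i
  set t := u i - u m with ht
  have h3 : Real.exp (u i) = Real.exp (u m) * Real.exp t := by
    rw [← Real.exp_add, ht]; congr 1; ring
  have h4 : t ≤ Real.exp t := by linarith [Real.add_one_le_exp t]
  have hμi := hμ i
  have ht0 : 0 ≤ t := by linarith
  have ht1 : 0 < t := by
    rcases ht0.eq_or_lt with h5 | h5
    · exfalso
      rw [← h5, mul_zero] at h1
      have := mul_pos hμi (show 0 < h i * Real.exp (u i) - c by
        have := mul_pos hi (Real.exp_pos (u i)); linarith)
      linarith
    · exact h5
  have h6 : -c * t ≤ H * Real.exp (u i) := by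
    rw [h3, ← mul_assoc]
    exact mul_le_mul h2 h4 ht0 (mul_nonneg hH.le (Real.exp_pos _).le)
  have h7 : μ i * h i * Real.exp (u i) ≤ D * t := by
    have := mul_pos hμi (neg_pos.2 hc)
    nlinarith
  have h8 : (-c * (μ i * h i)) * t ≤ (D * H) * t := by
    have e1 := mul_le_mul_of_nonneg_left h6 (mul_pos hμi hi).le
    have e2 := mul_le_mul_of_nonneg_left h7 hH.le
    linarith
  have h9 := le_of_mul_le_mul_right h8 ht1
  rw [neg_le, le_div_iff₀ (mul_pos hμi hi)]
  exact h9

theorem exp_bound (a D L : ℝ) (ha : 0 < a) (hD : 0 ≤ D) :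
    ∃ B, ∀ x, a * Real.exp x ≤ D * (x - L) → x ≤ B := by
  refine ⟨max 1 (2 * (D + |D * L|) / a), fun x hx => ?_⟩
  rcases le_total x 1 with h1 | h1
  · exact h1.trans (le_max_left _ _)
  · refine le_max_of_le_right ?_
    rw [le_div_iff₀ ha]
    have h2 := Real.quadratic_le_exp_of_nonneg (by linarith : 0 ≤ x)
    have h3 := neg_abs_le (D * L)
    have h4 := abs_nonneg (D * L)
    have h5 : a * (x ^ 2 / 2) ≤ D * x + |D * L| * x := by
      have : a * (x ^ 2 / 2) ≤ a * Real.exp x := mul_le_mul_of_nonneg_left (by linarith) ha.le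
      nlinarith
    have h6 : (x * a) * x ≤ (2 * (D + |D * L|)) * x := by linarith
    exact le_of_mul_le_mul_right h6 (by linarith)

theorem kw_pos_bound (hconn : G.Connected) (μ : V → ℝ) (hμ : ∀ i, 0 < μ i)
    (ω : V → V → ℝ) (hω : ∀ i j, G.Adj i j → 0 < ω i j) (h : V → ℝ) (L : ℝ) (i : V)
    (hi : 0 < h i) :
    ∃ B, ∀ c u, c < 0 → KWSol G μ ω h c u → (∀ i, L ≤ u i) → u i ≤ B := by
  obtain ⟨B, hB⟩ := exp_bound (μ i * h i) (∑ j ∈ G.neighborFinset i, ω i j) L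
    (mul_pos (hμ i) hi) (deg_nonneg G ω hω i)
  refine ⟨B, fun c u hc hu hL => hB _ ?_⟩
  have h1 := kw_pos_ineq G hconn μ ω hω h c u hu L hL i
  have h2 := mul_pos (hμ i) (neg_pos.2 hc)
  linarith

theorem kw_step (hconn : G.Connected) (μ : V → ℝ) (hμ : ∀ i, 0 < μ i)
    (ω : V → V → ℝ) (hω : ∀ i j, G.Adj i j → 0 < ω i j) (h : V → ℝ) (L C : ℝ) (a b : V)
    (hab : G.Adj a b) (K : ℝ) :
    ∃ B, ∀ c u M, c < 0 → -C ≤ c → KWSol G μ ω h c u → (∀ i, L ≤ u i) → (∀ i, u i ≤ M) →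
      M - K ≤ u a → M ≤ B ∨ M - B ≤ u b := by
  have hμa := hμ a
  set D := ∑ j ∈ G.neighborFinset a, ω a j with hD
  rcases lt_trichotomy (h a) 0 with ha | ha | ha
  · refine ⟨K + (D * K + μ a * C) / (μ a * (- h a)), fun c u M hc hC hu hL hM hK => Or.inl ?_⟩
    have h1 := ulap_le G ω hω u a K (fun j => by linarith [hM j])
    rw [hu a] at h1
    have h2 : u a ≤ (D * K + μ a * C) / (μ a * (- h a)) := by
      rw [le_div_iff₀ (mul_pos hμa (neg_pos.2 ha))]
      have h3 : u a ≤ Real.exp (u a) := by linarith [Real.add_one_le_exp (u a)]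
      have h4 := mul_le_mul_of_nonneg_right h3 (mul_pos hμa (neg_pos.2 ha)).le
      have h5 := mul_le_mul_of_nonneg_left hC hμa.le
      linarith
    linarith
  · refine ⟨(D * K + μ a * C) / ω a b, fun c u M hc hC hu hL hM hK => Or.inr ?_⟩
    have h1 := hu a
    rw [ha, zero_mul, sub_zero] at h1
    have h2 : ∑ j ∈ G.neighborFinset a, ω a j * (K - (u j - u a)) = D * K - ulap G ω u a := by
      unfold ulap
      rw [hD, Finset.sum_mul, ← Finset.sum_sub_distrib]
      exact Finset.sum_congr rfl fun j _ => by ring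
    have h3 : ω a b * (K - (u b - u a)) ≤ D * K - ulap G ω u a := by
      rw [← h2]
      refine Finset.single_le_sum (f := fun j => ω a j * (K - (u j - u a))) (fun j hj => ?_)
        (by simpa using hab)
      exact mul_nonneg (hω a j (by simpa using hj)).le (by linarith [hM j])
    have h5 := mul_le_mul_of_nonneg_left hC hμa.le
    have h6 : K - (u b - u a) ≤ (D * K + μ a * C) / ω a b := by
      rw [le_div_iff₀ (hω a b hab)]
      linarith
    linarith
  · obtain ⟨B, hB⟩ := kw_pos_bound G hconn μ hμ ω hω h L a ha
    refine ⟨B + K, fun c u M hc hC hu hL hM hK => Or.inl ?_⟩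
    have := hB c u hc hu hL
    linarith

theorem kw_walk (hconn : G.Connected) (μ : V → ℝ) (hμ : ∀ i, 0 < μ i)
    (ω : V → V → ℝ) (hω : ∀ i j, G.Adj i j → 0 < ω i j) (h : V → ℝ) (L C : ℝ) {a b : V}
    (p : G.Walk a b) :
    ∀ K, ∃ B, ∀ c u M, c < 0 → -C ≤ c → KWSol G μ ω h c u → (∀ i, L ≤ u i) → (∀ i, u i ≤ M) →
      M - K ≤ u a → M ≤ B ∨ M - B ≤ u b := by
  induction p with
  | nil => exact fun K => ⟨K, fun c u M _ _ _ _ _ hK => Or.inr hK⟩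
  | cons hadj p ih =>
    intro K
    obtain ⟨B1, hB1⟩ := kw_step G hconn μ hμ ω hω h L C _ _ hadj K
    obtain ⟨B2, hB2⟩ := ih B1
    refine ⟨max B1 B2, fun c u M hc hC hu hL hM hK => ?_⟩
    have e1 := le_max_left B1 B2
    have e2 := le_max_right B1 B2
    rcases hB1 c u M hc hC hu hL hM hK with h1 | h1
    · left; linarith
    · rcases hB2 c u M hc hC hu hL hM h1 with h2 | h2
      · left; linarith
      · right; linarith

theorem kw_upper (hconn : G.Connected) (μ : V → ℝ) (hμ : ∀ i, 0 < μ i)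
    (ω : V → V → ℝ) (hω : ∀ i j, G.Adj i j → 0 < ω i j) (h : V → ℝ) (hpos : ∃ i, 0 < h i)
    (L C : ℝ) :
    ∃ B, ∀ c u, c < 0 → -C ≤ c → KWSol G μ ω h c u → (∀ i, L ≤ u i) → ∀ i, u i ≤ B := by
  have := hconn.nonempty
  obtain ⟨i0, hi0⟩ := hpos
  obtain ⟨B0, hB0⟩ := kw_pos_bound G hconn μ hμ ω hω h L i0 hi0
  have hw : ∀ i, ∃ B, ∀ c u M, c < 0 → -C ≤ c → KWSol G μ ω h c u → (∀ i, L ≤ u i) →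
      (∀ i, u i ≤ M) → M - 0 ≤ u i → M ≤ B ∨ M - B ≤ u i0 := by
    intro i
    obtain ⟨p⟩ := hconn.preconnected i i0
    exact kw_walk G hconn μ hμ ω hω h L C p 0
  choose f hf using hw
  obtain ⟨F, hF⟩ := (Set.finite_range f).bddAbove
  refine ⟨F + |B0|, fun c u hc hC hu hL i => ?_⟩
  obtain ⟨m, hm⟩ := Finite.exists_max u
  have h1 := hF ⟨m, rfl⟩
  have h2 := hm i
  have h3 := hB0 c u hc hu hL
  have h4 := le_abs_self B0
  have h5 := abs_nonneg B0
  rcases hf m c u (u m) hc hC hu hL hm (by linarith) with h6 | h6 <;> linarith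

end KW


/-- Assume `h̄ < 0` and `h` is positive somewhere. Let
`S = {c < 0 : Δ u = c - h e^u is solvable}`. Then `S` is nonempty and bounded below,
`sInf S < 0`, and the Kazdan–Warner equation is solvable at `c = c₋(h) = sInf S`. -/
theorem stmt_7 {V : Type*} [Fintype V] (G : SimpleGraph V) [DecidableRel G.Adj]
    (hconn : G.Connected)
    (μ : V → ℝ) (hμ : ∀ i, 0 < μ i)
    (ω : V → V → ℝ) (hsym : ∀ i j, ω i j = ω j i)
    (hω : ∀ i j, G.Adj i j → 0 < ω i j)
    (h : V → ℝ)
    (havg : (∑ i, μ i * h i) / (∑ i, μ i) < 0)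
    (hpos : ∃ i, 0 < h i) :
    let S : Set ℝ := {c | c < 0 ∧ ∃ u : V → ℝ, ∀ i, glap G μ ω u i = c - h i * Real.exp (u i)}
    S.Nonempty ∧ BddBelow S ∧ sInf S < 0 ∧
      ∃ u : V → ℝ, ∀ i, glap G μ ω u i = sInf S - h i * Real.exp (u i) := by
  intro S
  have := hconn.nonempty
  have hS : ∀ c, c ∈ S ↔ c < 0 ∧ ∃ u, KWSol G μ ω h c u := fun c =>
    and_congr_right fun _ => exists_congr fun u => kwsol_iff G μ hμ ω h c u
  have hM : 0 < ∑ i, μ i := Finset.sum_pos (fun i _ => hμ i) Finset.univ_nonempty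
  have hneg : ∑ i, μ i * h i < 0 := by
    by_contra hc
    exact absurd havg (not_lt.2 (div_nonneg (not_lt.1 hc) hM.le))
  obtain ⟨c1, hc1, u1, hu1⟩ := kw_nonempty G hconn μ hμ ω hsym hω h hneg
  obtain ⟨C, hC⟩ := kw_bdd G hconn μ hμ ω hω h hpos
  have hH : 0 < ∑ k, |h k| := by
    obtain ⟨i, hi⟩ := hpos
    exact lt_of_lt_of_le (abs_pos.2 hi.ne')
      (Finset.single_le_sum (f := fun k => |h k|) (fun k _ => abs_nonneg _) (Finset.mem_univ i))
  let L : ℝ := Real.log (-c1 / ∑ k, |h k|)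
  have hL : ∀ c u, c ≤ c1 → KWSol G μ ω h c u → ∀ i, L ≤ u i := by
    intro c u hc hu i
    have h1 := kw_lower G hconn μ hμ ω hω h c u hu (by linarith) i
    refine (Real.log_le_iff_le_exp (div_pos (by linarith) hH)).2 ?_
    rw [div_le_iff₀ hH]
    linarith
  obtain ⟨B, hB⟩ := kw_upper G hconn μ hμ ω hω h hpos L C
  let P : Set (ℝ × (V → ℝ)) := (Set.Icc (-C) c1 ×ˢ Set.Icc (fun _ => L) (fun _ => B)) ∩
    ⋂ i, {p | ulap G ω p.2 i = μ i * (p.1 - h i * Real.exp (p.2 i))}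
  have hP : IsCompact P := by
    refine (isCompact_Icc.prod isCompact_Icc).inter_right (isClosed_iInter fun i => ?_)
    refine isClosed_eq ?_ (by fun_prop)
    unfold ulap; fun_prop
  have hmem : ∀ c u, c ≤ c1 → KWSol G μ ω h c u → (c, u) ∈ P := by
    intro c u hc hu
    have h0 : c < 0 := by linarith
    exact ⟨⟨⟨hC c u h0 hu, hc⟩, ⟨fun i => hL c u hc hu i,
      fun i => hB c u h0 (hC c u h0 hu) hu (hL c u hc hu) i⟩⟩, Set.mem_iInter.2 hu⟩
  obtain ⟨⟨c0, u0⟩, h0P, hmin⟩ := hP.exists_isMinOn (f := Prod.fst)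
    ⟨_, hmem c1 u1 le_rfl hu1⟩ continuous_fst.continuousOn
  have hc01 : c0 ≤ c1 := h0P.1.1.2
  have hu0 : KWSol G μ ω h c0 u0 := Set.mem_iInter.1 h0P.2
  have hleast : IsLeast S c0 := by
    refine ⟨(hS c0).2 ⟨by linarith, u0, hu0⟩, fun c hc => ?_⟩
    obtain ⟨_, u, hu⟩ := (hS c).1 hc
    rcases le_total c c1 with h1 | h1
    · exact hmin (hmem c u h1 hu)
    · linarith
  rw [hleast.csInf_eq]
  exact ⟨⟨c0, hleast.1⟩, ⟨c0, hleast.2⟩, by linarith, u0, (kwsol_iff G μ hμ ω h c0 u0).2 hu0⟩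
end

section
/- Assume the average value h̄ of h is negative and h_i > 0 for at least one vertex i ∈ V. Then there exists a real number c₀ with c₀ < 0 such that for every c < 0, the Kazdan–Warner equation Δu = c − h·e^u has a solution if and only if c ≥ c₀; that is, the set of negative parameters c for which the equation is solvable is exactly the interval [c₀, 0). -/
/-- Auxiliary Laplacian with general nonnegative kernel. -/
noncomputable def kwL {V : Type*} [Fintype V] (a : V → V → ℝ) (f : V → ℝ) (i : V) : ℝ :=
  ∑ j, a i j * (f j - f i)

theorem kwL_cont {V : Type*} [Fintype V] (a : V → V → ℝ) (i : V) :
    Continuous (fun f : V → ℝ => kwL a f i) := by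
  unfold kwL; fun_prop

/-- A supersolution gives a solution. -/
theorem kw_super {V : Type*} [Fintype V] (a : V → V → ℝ) (ha : ∀ i j, 0 ≤ a i j)
    (h : V → ℝ) (c : ℝ) (hc : c < 0) (U : V → ℝ)
    (hU : ∀ i, kwL a U i ≤ c - h i * Real.exp (U i)) :
    ∃ u : V → ℝ, ∀ i, kwL a u i = c - h i * Real.exp (u i) := by
  classical
  obtain ⟨A, hA⟩ : ∃ A : ℝ, ∀ i, -A ≤ U i ∧ c < h i * Real.exp (-A) := by
    have : ∀ᶠ A : ℝ in Filter.atTop, ∀ i, -A ≤ U i ∧ c < h i * Real.exp (-A) := by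
      rw [Filter.eventually_all]
      intro i
      have h1 : Filter.Tendsto (fun A : ℝ => h i * Real.exp (-A)) Filter.atTop (nhds (h i * 0)) :=
        (Real.tendsto_exp_neg_atTop_nhds_zero).const_mul _
      rw [mul_zero] at h1
      filter_upwards [h1.eventually (lt_mem_nhds hc), Filter.eventually_ge_atTop (-U i)] with A h2 h3
      exact ⟨by linarith, h2⟩
    exact this.exists
  set K : Set (V → ℝ) := {w | ∀ i, -A ≤ w i ∧ w i ≤ U i ∧ kwL a w i ≤ c - h i * Real.exp (w i)}
    with hK
  have hKc : IsCompact K := by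
    apply (isCompact_Icc (a := fun _ : V => -A) (b := U)).of_isClosed_subset
    · have : K = ⋂ i, ({w | -A ≤ w i} ∩ ({w | w i ≤ U i} ∩
          {w | kwL a w i ≤ c - h i * Real.exp (w i)})) := by
        ext w; simp [hK]
      rw [this]
      refine isClosed_iInter fun i => ?_
      refine (isClosed_le (by fun_prop) (by fun_prop)).inter
        ((isClosed_le (by fun_prop) (by fun_prop)).inter
        (isClosed_le (kwL_cont a i) (by fun_prop)))
    · intro w hw
      exact ⟨fun i => (hw i).1, fun i => (hw i).2.1⟩
  have hKn : K.Nonempty := ⟨U, fun i => ⟨(hA i).1, le_rfl, hU i⟩⟩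
  obtain ⟨w, hwK, hmin⟩ := hKc.exists_isMinOn hKn
    (f := fun w => ∑ i, w i) (by fun_prop)
  refine ⟨w, fun i => ?_⟩
  by_contra hne
  have hlt : kwL a w i < c - h i * Real.exp (w i) := lt_of_le_of_ne (hwK i).2.2 hne
  have hgt : -A < w i := by
    rcases (hwK i).1.lt_or_eq with h1 | h1
    · exact h1
    · exfalso
      have h2 : 0 ≤ kwL a w i := by
        unfold kwL
        refine Finset.sum_nonneg fun j _ => mul_nonneg (ha i j) ?_
        have := (hwK j).1
        linarith
      have := (hA i).2
      rw [h1] at this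
      linarith
  let v : ℝ → V → ℝ := fun e => Function.update w i (w i - e)
  have hv0 : v 0 = w := by simp [v]
  have hvc : Continuous v := by
    apply Continuous.update <;> fun_prop
  have e1 : ∀ᶠ e in nhds (0:ℝ), kwL a (v e) i < c - h i * Real.exp (v e i) := by
    have c1 : Continuous fun e => kwL a (v e) i := (kwL_cont a i).comp hvc
    have c2 : Continuous fun e => c - h i * Real.exp (v e i) := by
      have : Continuous fun e => v e i := (continuous_apply i).comp hvc
      fun_prop
    apply c1.continuousAt.eventually_lt c2.continuousAt
    rw [hv0]; exact hlt
  have e2 : ∀ᶠ e in nhds (0:ℝ), e < w i + A := gt_mem_nhds (by linarith)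
  obtain ⟨e, ⟨he1, he2⟩, he0⟩ :=
    (((e1.and e2).filter_mono nhdsWithin_le_nhds).and
      (self_mem_nhdsWithin (a := (0:ℝ)) (s := Set.Ioi 0))).exists
  have he0 : 0 < e := he0
  have hvi : v e i = w i - e := by simp [v]
  have hvj : ∀ j, j ≠ i → v e j = w j := fun j hj => by simp [v, hj]
  have hvle : ∀ j, v e j ≤ w j := by
    intro j
    by_cases hj : j = i
    · subst hj; rw [hvi]; linarith
    · rw [hvj j hj]
  have hvK : v e ∈ K := by
    intro j
    by_cases hj : j = i
    · subst hj
      refine ⟨by rw [hvi]; linarith, (hvle j).trans (hwK j).2.1, he1.le⟩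
    · rw [hvj j hj]
      refine ⟨(hwK j).1, (hwK j).2.1, le_trans ?_ (hwK j).2.2⟩
      unfold kwL
      refine Finset.sum_le_sum fun k _ => mul_le_mul_of_nonneg_left ?_ (ha j k)
      rw [hvj j hj]
      have := hvle k
      linarith
  have h3 : ∑ j, w j ≤ ∑ j, v e j := hmin hvK
  have h4 : ∑ j, v e j < ∑ j, w j :=
    Finset.sum_lt_sum (fun j _ => hvle j) ⟨i, Finset.mem_univ _, by rw [hvi]; linarith⟩
  linarith

/-- Lower bound for solutions. -/
theorem kw_lower_s8 {V : Type*} [Fintype V] (a : V → V → ℝ) (ha : ∀ i j, 0 ≤ a i j)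
    (h : V → ℝ) (H : ℝ) (hH0 : 0 < H) (hH : ∀ i, -h i ≤ H) (c : ℝ) (hc : c < 0) (u : V → ℝ)
    (hu : ∀ i, kwL a u i = c - h i * Real.exp (u i)) (i : V) : Real.log (-c / H) ≤ u i := by
  haveI : Nonempty V := ⟨i⟩
  obtain ⟨k, hk⟩ := Finite.exists_min u
  refine le_trans ?_ (hk i)
  have h0 : 0 ≤ kwL a u k := by
    unfold kwL
    refine Finset.sum_nonneg fun j _ => mul_nonneg (ha k j) ?_
    have := hk j
    linarith
  rw [hu k] at h0
  rw [Real.log_le_iff_le_exp (div_pos (by linarith) hH0), div_le_iff₀ hH0]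
  nlinarith [Real.exp_pos (u k), hH k]

/-- If `u` is bounded below by `m`, the Laplacian is bounded below. -/
theorem kwL_ge {V : Type*} [Fintype V] (a : V → V → ℝ) (ha : ∀ i j, 0 ≤ a i j)
    (u : V → ℝ) (m : ℝ) (hm : ∀ i, m ≤ u i) (i : V) :
    -((∑ j, a i j) * (u i - m)) ≤ kwL a u i := by
  unfold kwL
  rw [Finset.sum_mul, ← Finset.sum_neg_distrib]
  refine Finset.sum_le_sum fun j _ => ?_
  nlinarith [ha i j, hm j]

/-- Lower bound on `c`. -/
theorem kw_c_lower {V : Type*} [Fintype V] (a : V → V → ℝ) (ha : ∀ i j, 0 ≤ a i j)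
    (h : V → ℝ) (H : ℝ) (hH0 : 0 < H) (hH : ∀ i, -h i ≤ H) (c : ℝ) (hc : c < 0) (u : V → ℝ)
    (hu : ∀ i, kwL a u i = c - h i * Real.exp (u i)) (i : V) (hi : 0 < h i) :
    -((∑ j, a i j) * H / h i) ≤ c := by
  have h1 := kw_lower_s8 a ha h H hH0 hH c hc u hu
  have h2 := kwL_ge a ha u _ h1 i
  rw [hu i] at h2
  set m := Real.log (-c / H) with hm
  have hem : Real.exp m = -c / H := Real.exp_log (div_pos (by linarith) hH0)
  set W := ∑ j, a i j
  have hW : 0 ≤ W := Finset.sum_nonneg fun j _ => ha i j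
  obtain ⟨s, hs⟩ : ∃ s, s = u i - m := ⟨_, rfl⟩
  have hus : u i = m + s := by linarith
  rw [← hs, hus, Real.exp_add, hem] at h2
  have h3 := Real.add_one_le_exp s
  have h4 : h i * (-c / H * Real.exp s) ≤ W * Real.exp s := by nlinarith
  have h5 : h i * (-c / H) ≤ W := by
    have : (h i * (-c / H)) * Real.exp s ≤ W * Real.exp s := by linarith
    exact le_of_mul_le_mul_right this (Real.exp_pos s)
  have h6 : h i * (-c) ≤ W * H := by
    rw [← mul_div_assoc, div_le_iff₀ hH0] at h5; exact h5
  have h7 : -c ≤ W * H / h i := by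
    rw [le_div_iff₀ hi]; linarith
  linarith

theorem kw_exp_bound (η W D t : ℝ) (hη : 0 < η) (hW : 0 ≤ W) (hD : 0 ≤ D)
    (ht : η * Real.exp t ≤ W * t + D) : t ≤ 2 * (W + D) / η + 1 := by
  by_contra hcon
  push Not at hcon
  have h0 : 0 ≤ 2 * (W + D) / η := by positivity
  have ht1 : 1 < t := by linarith
  have h1 := Real.quadratic_le_exp_of_nonneg (by linarith : (0:ℝ) ≤ t)
  have h2 : 2 * (W + D) / η < t := by linarith
  rw [div_lt_iff₀ hη] at h2
  have h3 : W * t + D ≤ (W + D) * t := by nlinarith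
  have h4 : η * (t^2/2) ≤ η * Real.exp t := mul_le_mul_of_nonneg_left (by linarith) hη.le
  nlinarith

/-- Upper bound, by propagation along a walk. -/
theorem kw_walk_s8 {V : Type*} [Fintype V] (G : SimpleGraph V) (a : V → V → ℝ)
    (ha : ∀ i j, 0 ≤ a i j) (hadj : ∀ i j, G.Adj i j → 0 < a i j)
    (h : V → ℝ) (c₂ m : ℝ) {j i₀ : V} (p : G.Walk j i₀) (hi₀ : 0 < h i₀) :
    ∀ C : ℝ, ∃ B : ℝ, ∀ (c : ℝ) (u : V → ℝ) (M : ℝ), c₂ ≤ c → c < 0 → (∀ i, m ≤ u i) →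
      (∀ i, u i ≤ M) → (∀ i, kwL a u i = c - h i * Real.exp (u i)) → M - u j ≤ C → M ≤ B := by
  have base : ∀ j, 0 < h j → ∀ C : ℝ, ∃ B : ℝ, ∀ (c : ℝ) (u : V → ℝ) (M : ℝ), c₂ ≤ c → c < 0 →
      (∀ i, m ≤ u i) → (∀ i, u i ≤ M) → (∀ i, kwL a u i = c - h i * Real.exp (u i)) →
      M - u j ≤ C → M ≤ B := by
    intro j hj C
    refine ⟨(2 * ((∑ k, a j k) + (∑ k, a j k) * |m|) / h j + 1) + C, ?_⟩
    intro c u M _ hc hm _ hu hC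
    have hW : 0 ≤ ∑ k, a j k := Finset.sum_nonneg fun k _ => ha j k
    have h2 := kwL_ge a ha u m hm j
    rw [hu j] at h2
    have h3 := kw_exp_bound (h j) (∑ k, a j k) ((∑ k, a j k) * |m|) (u j) hj hW (by positivity)
      (by nlinarith [neg_abs_le m])
    linarith
  induction p with
  | nil => exact base _ hi₀
  | @cons j k l hjk p ih =>
    intro C
    by_cases hj : 0 < h j
    · exact base j hj C
    push Not at hj
    have hapos := hadj j k hjk
    obtain ⟨B, hB⟩ := ih hi₀ (C + ((∑ k, a j k) * C - c₂) / a j k)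
    refine ⟨B, fun c u M hc2 hc hm hM hu hC => hB c u M hc2 hc hm hM hu ?_⟩
    have hge : c₂ ≤ kwL a u j := by
      rw [hu j]; nlinarith [Real.exp_pos (u j)]
    have hle : a j k * (M - u k) ≤ ∑ l, a j l * (M - u l) :=
      Finset.single_le_sum (f := fun l => a j l * (M - u l))
        (fun l _ => mul_nonneg (ha j l) (by linarith [hM l])) (Finset.mem_univ k)
    have hsum : ∑ l, a j l * (M - u l) = (∑ l, a j l) * (M - u j) - kwL a u j := by
      unfold kwL
      rw [Finset.sum_mul, ← Finset.sum_sub_distrib]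
      exact Finset.sum_congr rfl fun l _ => by ring
    have hW : 0 ≤ ∑ l, a j l := Finset.sum_nonneg fun l _ => ha j l
    have hC0 : 0 ≤ C := le_trans (by linarith [hM j]) hC
    have h5 : (M - u k) ≤ ((∑ k, a j k) * C - c₂) / a j k := by
      rw [le_div_iff₀ hapos]
      nlinarith
    linarith

/-- Uniform upper bound. -/
theorem kw_upper_s8 {V : Type*} [Fintype V] (G : SimpleGraph V) (hconn : G.Connected) (a : V → V → ℝ)
    (ha : ∀ i j, 0 ≤ a i j) (hadj : ∀ i j, G.Adj i j → 0 < a i j)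
    (h : V → ℝ) (c₂ m : ℝ) (i₀ : V) (hi₀ : 0 < h i₀) :
    ∃ B : ℝ, ∀ (c : ℝ) (u : V → ℝ), c₂ ≤ c → c < 0 → (∀ i, m ≤ u i) →
      (∀ i, kwL a u i = c - h i * Real.exp (u i)) → ∀ i, u i ≤ B := by
  have key : ∀ j, ∃ B : ℝ, ∀ (c : ℝ) (u : V → ℝ) (M : ℝ), c₂ ≤ c → c < 0 → (∀ i, m ≤ u i) →
      (∀ i, u i ≤ M) → (∀ i, kwL a u i = c - h i * Real.exp (u i)) → M - u j ≤ 0 → M ≤ B := by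
    intro j
    obtain ⟨p⟩ := hconn.preconnected j i₀
    exact kw_walk_s8 G a ha hadj h c₂ m p hi₀ 0
  choose B hB using key
  haveI : Nonempty V := ⟨i₀⟩
  obtain ⟨k, hk⟩ := Finite.exists_max B
  refine ⟨B k, fun c u h1 h2 h3 h4 i => ?_⟩
  obtain ⟨l, hl⟩ := Finite.exists_max u
  exact (hl i).trans ((hB l c u (u l) h1 h2 h3 hl h4 (by simp)).trans (hk l))

/-- Some negative `c` is solvable as soon as `Δ v = η - h` with `η < 0` is solvable. -/
theorem kw_exists {V : Type*} [Fintype V] (a : V → V → ℝ) (ha : ∀ i j, 0 ≤ a i j)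
    (h : V → ℝ) (η : ℝ) (hη : η < 0) (v : V → ℝ) (hv : ∀ i, kwL a v i = η - h i) :
    ∃ c < 0, ∃ u : V → ℝ, ∀ i, kwL a u i = c - h i * Real.exp (u i) := by
  have e1 : ∀ᶠ t in nhds (0:ℝ), ∀ i, h i * (Real.exp (t * v i) - 1) < -η / 2 := by
    rw [Filter.eventually_all]
    intro i
    have c1 : Continuous fun t : ℝ => h i * (Real.exp (t * v i) - 1) := by fun_prop
    apply c1.continuousAt.eventually_lt continuousAt_const
    simp; linarith
  obtain ⟨t, ht, ht0⟩ := ((e1.filter_mono nhdsWithin_le_nhds).and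
      (self_mem_nhdsWithin (a := (0:ℝ)) (s := Set.Ioi 0))).exists
  have ht0 : 0 < t := ht0
  have hc : t * η / 2 < 0 := by nlinarith
  refine ⟨t * η / 2, hc, kw_super a ha h _ hc (fun i => t * v i + Real.log t) fun i => ?_⟩
  have h1 : kwL a (fun i => t * v i + Real.log t) i = t * (η - h i) := by
    rw [← hv i]
    unfold kwL
    rw [Finset.mul_sum]
    exact Finset.sum_congr rfl fun l _ => by ring
  rw [h1, Real.exp_add, Real.exp_log ht0]
  nlinarith [mul_lt_mul_of_pos_left (ht i) ht0]

/-- Solvability of the Poisson equation. -/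
theorem kw_poisson {V : Type*} [Fintype V] (G : SimpleGraph V) (hconn : G.Connected)
    (b : V → V → ℝ) (hb : ∀ i j, 0 ≤ b i j) (hsym : ∀ i j, b i j = b j i)
    (hadj : ∀ i j, G.Adj i j → 0 < b i j) (g : V → ℝ) (hg : ∑ i, g i = 0) :
    ∃ v : V → ℝ, ∀ i, kwL b v i = g i := by
  haveI := hconn.nonempty
  have hsum : ∀ f : V → ℝ, ∑ i, kwL b f i = 0 := by
    intro f
    have h1 : ∑ i, kwL b f i = ∑ i, ∑ j, b i j * (f i - f j) := by
      unfold kwL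
      rw [Finset.sum_comm]
      exact Finset.sum_congr rfl fun i _ => Finset.sum_congr rfl fun j _ => by rw [hsym]
    have h2 : ∑ i, ∑ j, b i j * (f i - f j) = - ∑ i, kwL b f i := by
      unfold kwL
      simp only [← Finset.sum_neg_distrib]
      exact Finset.sum_congr rfl fun i _ => Finset.sum_congr rfl fun j _ => by ring
    linarith
  let S : (V → ℝ) →ₗ[ℝ] (V → ℝ) :=
    { toFun := fun f i => kwL b f i + ∑ k, f k
      map_add' := by
        intro f g; ext i
        simp only [kwL, Pi.add_apply, Finset.sum_add_distrib]
        have : ∑ j, b i j * (f j + g j - (f i + g i)) =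
            ∑ j, b i j * (f j - f i) + ∑ j, b i j * (g j - g i) := by
          rw [← Finset.sum_add_distrib]
          exact Finset.sum_congr rfl fun j _ => by ring
        rw [this]; ring
      map_smul' := by
        intro r f; ext i
        simp only [kwL, Pi.smul_apply, smul_eq_mul, RingHom.id_apply, mul_add, Finset.mul_sum]
        congr 1
        exact Finset.sum_congr rfl fun j _ => by ring }
  have hS : ∀ f i, S f i = kwL b f i + ∑ k, f k := fun _ _ => rfl
  have hSsum : ∀ f, ∑ i, S f i = (Fintype.card V : ℝ) * ∑ k, f k := by
    intro f
    simp only [hS, Finset.sum_add_distrib, hsum, zero_add, Finset.sum_const, Finset.card_univ,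
      nsmul_eq_mul]
  have hcard : (Fintype.card V : ℝ) ≠ 0 := by
    exact_mod_cast Fintype.card_ne_zero
  have hinj : Function.Injective S := by
    rw [injective_iff_map_eq_zero]
    intro f hf
    have h1 : ∑ k, f k = 0 := by
      have := hSsum f
      rw [hf] at this
      simp only [Pi.zero_apply, Finset.sum_const_zero] at this
      rcases mul_eq_zero.1 this.symm with h | h
      · exact absurd h hcard
      · exact h
    have h2 : ∀ i, kwL b f i = 0 := by
      intro i
      have := hS f i
      rw [hf, h1] at this
      simpa using this.symm
    obtain ⟨k, hk⟩ := Finite.exists_max f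
    have step : ∀ i j, G.Adj i j → f i = f k → f j = f k := by
      intro i j hij hi
      have h3 : ∑ l, b i l * (f k - f l) = 0 := by
        have := h2 i
        unfold kwL at this
        rw [hi] at this
        rw [← neg_eq_zero, ← this, ← Finset.sum_neg_distrib]
        exact Finset.sum_congr rfl fun j _ => by ring
      rw [Finset.sum_eq_zero_iff_of_nonneg
        (fun l _ => mul_nonneg (hb i l) (by linarith [hk l]))] at h3
      have h4 := h3 j (Finset.mem_univ j)
      rcases mul_eq_zero.1 h4 with h | h
      · exact absurd h (hadj i j hij).ne'
      · linarith
    have hall : ∀ i, f i = f k := by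
      intro i
      obtain ⟨p⟩ := hconn.preconnected i k
      induction p with
      | nil => rfl
      | cons hij p ih => exact step _ _ hij.symm (ih hk step)
    have h5 : (Fintype.card V : ℝ) * f k = 0 := by
      rw [← h1, Finset.sum_congr rfl (fun i _ => hall i)]
      simp
    have h6 : f k = 0 := (mul_eq_zero.1 h5).resolve_left hcard
    ext i
    rw [hall i, h6]; rfl
  obtain ⟨v, hv⟩ := (LinearMap.injective_iff_surjective.1 hinj) g
  have h1 : ∑ k, v k = 0 := by
    have := hSsum v
    rw [hv, hg] at this
    exact (mul_eq_zero.1 this.symm).resolve_left hcard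
  refine ⟨v, fun i => ?_⟩
  rw [← hv, hS, h1, add_zero]


/-- Assume `h̄ < 0` and `h` is positive somewhere. Then there is `c₀ < 0` such that for
every `c < 0`, the Kazdan–Warner equation `Δ u = c - h e^u` is solvable iff `c ≥ c₀`;
i.e. the set of negative solvable parameters is exactly `[c₀, 0)`. -/
theorem stmt_8 {V : Type*} [Fintype V] (G : SimpleGraph V) [DecidableRel G.Adj]
    (hconn : G.Connected)
    (μ : V → ℝ) (hμ : ∀ i, 0 < μ i)
    (ω : V → V → ℝ) (hsym : ∀ i j, ω i j = ω j i)
    (hω : ∀ i j, G.Adj i j → 0 < ω i j)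
    (h : V → ℝ)
    (havg : (∑ i, μ i * h i) / (∑ i, μ i) < 0)
    (hpos : ∃ i, 0 < h i) :
    ∃ c₀ : ℝ, c₀ < 0 ∧ ∀ c < (0 : ℝ),
      ((∃ u : V → ℝ, ∀ i, glap G μ ω u i = c - h i * Real.exp (u i)) ↔ c₀ ≤ c) := by

  classical
  obtain ⟨i₀, hi₀⟩ := hpos
  let b : V → V → ℝ := fun i j => if G.Adj i j then ω i j else 0
  let a : V → V → ℝ := fun i j => b i j / μ i
  have hb : ∀ i j, 0 ≤ b i j := by
    intro i j
    by_cases hij : G.Adj i j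
    · simp only [b, if_pos hij]; exact (hω i j hij).le
    · simp [b, hij]
  have hbadj : ∀ i j, G.Adj i j → 0 < b i j := by
    intro i j hij
    simp only [b, if_pos hij]; exact hω i j hij
  have hbsym : ∀ i j, b i j = b j i := by
    intro i j
    simp only [b, G.adj_comm i j, hsym i j]
  have ha : ∀ i j, 0 ≤ a i j := fun i j => div_nonneg (hb i j) (hμ i).le
  have hadj : ∀ i j, G.Adj i j → 0 < a i j := fun i j hij => div_pos (hbadj i j hij) (hμ i)
  have hab : ∀ u i, kwL a u i = (1 / μ i) * kwL b u i := by
    intro u i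
    simp only [kwL, a, Finset.mul_sum]
    exact Finset.sum_congr rfl fun j _ => by ring
  have hlap : ∀ u i, glap G μ ω u i = kwL a u i := by
    intro u i
    rw [hab]
    simp only [glap, kwL, b]
    congr 1
    rw [SimpleGraph.neighborFinset_eq_filter, Finset.sum_filter]
    exact Finset.sum_congr rfl fun j _ => by split_ifs <;> simp
  simp only [hlap]
  -- Poisson equation
  set η := (∑ i, μ i * h i) / (∑ i, μ i) with hη
  have hμs : 0 < ∑ i, μ i := Finset.sum_pos (fun i _ => hμ i) ⟨i₀, Finset.mem_univ _⟩
  obtain ⟨v, hv⟩ := kw_poisson G hconn b hb hbsym hbadj (fun i => μ i * (η - h i)) (by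
    simp only [mul_sub, Finset.sum_sub_distrib, ← Finset.sum_mul]
    rw [hη]; field_simp; ring)
  obtain ⟨c₁, hc₁, u₁, hu₁⟩ := kw_exists a ha h η havg v (fun i => by
    rw [hab, hv]; have := (hμ i).ne'; field_simp)
  -- bounds
  obtain ⟨H, hH0, hH⟩ : ∃ H : ℝ, 0 < H ∧ ∀ i, -h i ≤ H := by
    refine ⟨∑ i, |h i| + 1, by positivity, fun i => ?_⟩
    have := Finset.single_le_sum (f := fun i => |h i|) (fun l _ => abs_nonneg _)
      (Finset.mem_univ i)
    have := neg_le_abs (h i)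
    linarith
  set c₂ := -((∑ j, a i₀ j) * H / h i₀)
  set m := Real.log (-c₁ / H)
  obtain ⟨B, hB⟩ := kw_upper_s8 G hconn a ha hadj h c₂ m i₀ hi₀
  set K : Set (ℝ × (V → ℝ)) :=
    {p | p.1 ≤ c₁ ∧ ∀ i, kwL a p.2 i = p.1 - h i * Real.exp (p.2 i)} with hK
  have hKc : IsCompact K := by
    apply ((isCompact_Icc (a := c₂) (b := c₁)).prod
      (isCompact_Icc (a := fun _ : V => m) (b := fun _ => B))).of_isClosed_subset
    · have : K = {p | p.1 ≤ c₁} ∩ ⋂ i, {p | kwL a p.2 i = p.1 - h i * Real.exp (p.2 i)} := by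
        ext p; simp [hK]
      rw [this]
      refine (isClosed_le (by fun_prop) (by fun_prop)).inter (isClosed_iInter fun i => ?_)
      exact isClosed_eq ((kwL_cont a i).comp continuous_snd) (by fun_prop)
    · rintro ⟨c, u⟩ ⟨hc, hu⟩
      simp only at hc hu
      have hc0 : c < 0 := by linarith
      have h1 : c₂ ≤ c := kw_c_lower a ha h H hH0 hH c hc0 u hu i₀ hi₀
      have h2 : ∀ i, m ≤ u i := fun i => by
        refine le_trans ?_ (kw_lower_s8 a ha h H hH0 hH c hc0 u hu i)
        apply Real.log_le_log (div_pos (by linarith) hH0)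
        gcongr
      exact ⟨⟨h1, hc⟩, h2, hB c u h1 hc0 h2 hu⟩
  obtain ⟨⟨c₀, u₀⟩, ⟨hc₀, hu₀⟩, hmin⟩ := hKc.exists_isMinOn ⟨(c₁, u₁), le_rfl, hu₁⟩
    (f := fun p => p.1) (by fun_prop)
  simp only at hc₀ hu₀
  refine ⟨c₀, by linarith, fun c hc => ⟨?_, fun hcc => ?_⟩⟩
  · rintro ⟨u, hu⟩
    rcases le_total c c₁ with h1 | h1
    · exact hmin (show (c, u) ∈ K from ⟨h1, hu⟩)
    · exact hc₀.trans h1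
  · refine kw_super a ha h c hc u₀ fun i => ?_
    rw [hu₀ i]; linarith
end
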